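/- The submodule I_f^# equals the colon submodule (R_f : I_f) := {x ∈ Q_f : x·y ∈ R_f for all y ∈ I_f}. -/

import Mathlib

open Polynomial

noncomputable section

/-- The polynomial `f₀ Tⁿ + f₁ Tⁿ⁻¹ + ⋯ + fₙ` over `ℚ`. -/
def fpoly (n : ℕ) (f : ℕ → ℤ) : Polynomial ℚ :=
  ∑ i ∈ Finset.range (n + 1), Polynomial.C (f i : ℚ) * Polynomial.X ^ (n - i)

/-- `Q_f = ℚ[T]/(f₀ Tⁿ + ⋯ + fₙ)`. -/
abbrev Qf (n : ℕ) (f : ℕ → ℤ) := AdjoinRoot (fpoly n f)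

/-- `θ`, the image of `T` in `Q_f`. -/
def th (n : ℕ) (f : ℕ → ℤ) : Qf n f := AdjoinRoot.root _

/-- `ζ₀ = 1`, and `ζ_k = f₀ θ^k + f₁ θ^(k-1) + ⋯ + f_(k-1) θ` for `k ≥ 1`. -/
def zeta (n : ℕ) (f : ℕ → ℤ) (k : ℕ) : Qf n f :=
  if k = 0 then 1 else ∑ i ∈ Finset.range k, (f i : Qf n f) * th n f ^ (k - i)

/-- `R_f`, the ℤ-span of `ζ₀, …, ζ_(n-1)` in `Q_f`. -/
def Rf (n : ℕ) (f : ℕ → ℤ) : Submodule ℤ (Qf n f) :=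
  Submodule.span ℤ (Set.range fun k : Fin n => zeta n f k)

/-- `I_f`, the `R_f`-submodule of `Q_f` generated by `1` and `θ`,
as a ℤ-submodule of `Q_f`. -/
def If (n : ℕ) (f : ℕ → ℤ) : Submodule ℤ (Qf n f) :=
  Rf n f * Submodule.span ℤ {1, th n f}

/-- `I_f^#`, the ℤ-span of `f₀, f₀θ + f₁, …, f₀θ^(n-1) + f₁θ^(n-2) + ⋯ + f_(n-1)`. -/
def Ish (n : ℕ) (f : ℕ → ℤ) : Submodule ℤ (Qf n f) :=
  Submodule.span ℤ (Set.range fun j : Fin n =>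
    ∑ i ∈ Finset.range ((j : ℕ) + 1), (f i : Qf n f) * th n f ^ ((j : ℕ) - i))

/-- `f₀ θ^k + f₁ θ^(k-1) + ⋯ + f_(k-1) θ`, which is `ζ_k` for `k ≥ 1` and `0` for `k = 0`. -/
def zetaSum (n : ℕ) (f : ℕ → ℤ) (k : ℕ) : Qf n f :=
  ∑ i ∈ Finset.range k, (f i : Qf n f) * th n f ^ (k - i)

lemma zeta_zero (n : ℕ) (f : ℕ → ℤ) : zeta n f 0 = 1 := if_pos rfl

lemma zeta_of_ne_zero {n : ℕ} {f : ℕ → ℤ} {k : ℕ} (hk : k ≠ 0) :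
    zeta n f k = zetaSum n f k := if_neg hk

lemma zetaSum_zero (n : ℕ) (f : ℕ → ℤ) : zetaSum n f 0 = 0 := by simp [zetaSum]

lemma sum_range_succ_eq_zetaSum_add (n : ℕ) (f : ℕ → ℤ) (k : ℕ) :
    ∑ i ∈ Finset.range (k + 1), (f i : Qf n f) * th n f ^ (k - i) = zetaSum n f k + f k := by
  simp [zetaSum, Finset.sum_range_succ]

lemma zetaSum_succ (n : ℕ) (f : ℕ → ℤ) (k : ℕ) :
    zetaSum n f (k + 1) = th n f * (zetaSum n f k + f k) := by
  rw [← sum_range_succ_eq_zetaSum_add, zetaSum, Finset.mul_sum]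
  refine Finset.sum_congr rfl fun i hi => ?_
  rw [Nat.succ_sub (Finset.mem_range_succ_iff.mp hi), pow_succ]
  ring

lemma zetaSum_self (n : ℕ) (f : ℕ → ℤ) : zetaSum n f n = -f n := by
  rw [eq_neg_iff_add_eq_zero, ← sum_range_succ_eq_zetaSum_add]
  have h : aeval (th n f)
      (∑ i ∈ Finset.range (n + 1), C (f i : ℚ) * X ^ (n - i)) = 0 :=
    (AdjoinRoot.aeval_eq _).trans AdjoinRoot.mk_self
  simpa using h

lemma zetaSum_succ_mul (n : ℕ) (f : ℕ → ℤ) (i j : ℕ) :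
    zetaSum n f (i + 1) * zetaSum n f j =
      zetaSum n f i * zetaSum n f (j + 1) - f j * zetaSum n f (i + 1)
        + f i * zetaSum n f (j + 1) := by
  simp only [zetaSum_succ]
  ring

lemma zeta_mem_Rf {n : ℕ} (f : ℕ → ℤ) {k : ℕ} (hk : k < n) : zeta n f k ∈ Rf n f :=
  Submodule.subset_span ⟨⟨k, hk⟩, rfl⟩

lemma one_mem_Rf {n : ℕ} (hn : 0 < n) (f : ℕ → ℤ) : (1 : Qf n f) ∈ Rf n f :=
  zeta_zero n f ▸ zeta_mem_Rf f hn

lemma intCast_mul_mem {n : ℕ} {f : ℕ → ℤ} {M : Submodule ℤ (Qf n f)} (c : ℤ) {x : Qf n f}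
    (hx : x ∈ M) : (c : Qf n f) * x ∈ M := by
  rw [← zsmul_eq_mul]
  exact M.smul_mem c hx

lemma intCast_mem_Rf {n : ℕ} (hn : 0 < n) (f : ℕ → ℤ) (c : ℤ) : (c : Qf n f) ∈ Rf n f :=
  mul_one (c : Qf n f) ▸ intCast_mul_mem c (one_mem_Rf hn f)

lemma zetaSum_mem_Rf {n : ℕ} (hn : 0 < n) (f : ℕ → ℤ) {k : ℕ} (hk : k ≤ n) :
    zetaSum n f k ∈ Rf n f := by
  rcases hk.eq_or_lt with rfl | hk
  · rw [zetaSum_self]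
    exact neg_mem (intCast_mem_Rf hn f _)
  · rcases eq_or_ne k 0 with rfl | h0
    · rw [zetaSum_zero]
      exact zero_mem _
    · exact zeta_of_ne_zero (f := f) h0 ▸ zeta_mem_Rf f hk

lemma zetaSum_mul_zetaSum_mem_Rf {n : ℕ} (hn : 0 < n) (f : ℕ → ℤ) {i j : ℕ} (hi : i ≤ n)
    (hj : j ≤ n) : zetaSum n f i * zetaSum n f j ∈ Rf n f := by
  induction i generalizing j with
  | zero => simp [zetaSum_zero]
  | succ i ih =>
    rcases hj.eq_or_lt with rfl | hj
    · rw [zetaSum_self, mul_neg, mul_comm]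
      exact neg_mem (intCast_mul_mem _ (zetaSum_mem_Rf hn f hi))
    · rw [zetaSum_succ_mul]
      exact add_mem (sub_mem (ih (by omega) hj) (intCast_mul_mem _ (zetaSum_mem_Rf hn f hi)))
        (intCast_mul_mem _ (zetaSum_mem_Rf hn f hj))

lemma mul_mem_Rf {n : ℕ} (hn : 0 < n) {f : ℕ → ℤ} {x y : Qf n f} (hx : x ∈ Rf n f)
    (hy : y ∈ Rf n f) : x * y ∈ Rf n f := by
  suffices h : Rf n f * Rf n f ≤ Rf n f from h (Submodule.mul_mem_mul hx hy)
  conv_lhs => rw [Rf, Submodule.span_mul_span]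
  rw [Submodule.span_le]
  rintro _ ⟨_, ⟨i, rfl⟩, _, ⟨j, rfl⟩, rfl⟩
  change zeta n f i * zeta n f j ∈ Rf n f
  rcases eq_or_ne (i : ℕ) 0 with hi | hi
  · rw [hi, zeta_zero, one_mul]
    exact zeta_mem_Rf f j.2
  rcases eq_or_ne (j : ℕ) 0 with hj | hj
  · rw [hj, zeta_zero, mul_one]
    exact zeta_mem_Rf f i.2
  rw [zeta_of_ne_zero hi, zeta_of_ne_zero hj]
  exact zetaSum_mul_zetaSum_mem_Rf hn f i.2.le j.2.le

lemma natDegree_fpoly (n : ℕ) {f : ℕ → ℤ} (hf0 : f 0 ≠ 0) : (fpoly n f).natDegree = n := by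
  refine natDegree_eq_of_le_of_coeff_ne_zero ?_ ?_
  · exact natDegree_sum_le_of_forall_le _ _ fun i _ =>
      (natDegree_C_mul_X_pow_le _ _).trans (Nat.sub_le _ _)
  · have : (fpoly n f).coeff n = f 0 := by
      rw [fpoly, finsetSum_coeff, Finset.sum_eq_single 0]
      · simp
      · intro i hi h0
        rw [coeff_C_mul_X_pow, if_neg]
        have := Finset.mem_range.mp hi
        omega
      · simp
    rw [this]
    exact_mod_cast hf0

lemma th_mul_zetaSum (n : ℕ) (f : ℕ → ℤ) (k : ℕ) :
    th n f * zetaSum n f k = zetaSum n f (k + 1) - f k * th n f := by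
  rw [zetaSum_succ]
  ring

lemma zetaSum_one (n : ℕ) (f : ℕ → ℤ) : zetaSum n f 1 = f 0 * th n f := by
  rw [zetaSum_succ, zetaSum_zero, zero_add, mul_comm]

lemma zeta_one (n : ℕ) (f : ℕ → ℤ) : zeta n f 1 = f 0 * th n f := by
  rw [zeta_of_ne_zero one_ne_zero, zetaSum_one]

lemma th_eq_smul_zeta_one (n : ℕ) {f : ℕ → ℤ} (hf0 : f 0 ≠ 0) :
    th n f = (f 0 : ℚ)⁻¹ • zeta n f 1 := by
  have h : (f 0 : ℚ) ≠ 0 := by exact_mod_cast hf0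
  rw [zeta_one, ← zsmul_eq_mul, ← Int.cast_smul_eq_zsmul ℚ, inv_smul_smul₀ h]

lemma span_zeta_eq_top {n : ℕ} (hn : 2 ≤ n) {f : ℕ → ℤ} (hf0 : f 0 ≠ 0) :
    Submodule.span ℚ (Set.range fun k : Fin n => zeta n f k) = ⊤ := by
  set S := Submodule.span ℚ (Set.range fun k : Fin n => zeta n f k) with hS
  have hRS : Rf n f ≤ S.restrictScalars ℤ := Submodule.span_le_restrictScalars ℤ ℚ _
  have hth : th n f ∈ S := by
    rw [th_eq_smul_zeta_one n hf0]
    exact S.smul_mem _ (hRS (zeta_mem_Rf f hn))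
  have hmul : ∀ x ∈ S, th n f * x ∈ S := by
    intro x hx
    induction hx using Submodule.span_induction with
    | zero => simp
    | add x y _ _ hx hy => rw [mul_add]; exact add_mem hx hy
    | smul c x _ hx => rw [mul_smul_comm]; exact S.smul_mem c hx
    | mem x hx =>
      obtain ⟨k, rfl⟩ := hx
      change th n f * zeta n f k ∈ S
      rcases eq_or_ne (k : ℕ) 0 with hk | hk
      · rwa [hk, zeta_zero, mul_one]
      · rw [zeta_of_ne_zero hk, th_mul_zetaSum]
        refine sub_mem (hRS (zetaSum_mem_Rf (by omega) f k.2)) ?_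
        rw [← zsmul_eq_mul]
        exact zsmul_mem hth _
  have hpow : ∀ k, th n f ^ k ∈ S := by
    intro k
    induction k with
    | zero => rw [pow_zero]; exact hRS (one_mem_Rf (by omega) f)
    | succ k ih => rw [pow_succ']; exact hmul _ ih
  rw [eq_top_iff]
  rintro x -
  induction x using AdjoinRoot.induction_on with
  | ih p =>
    rw [← AdjoinRoot.aeval_eq, aeval_eq_sum_range]
    exact sum_mem fun k _ => S.smul_mem _ (hpow k)

lemma linearIndependent_zeta {n : ℕ} (hn : 2 ≤ n) {f : ℕ → ℤ} (hf0 : f 0 ≠ 0) :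
    LinearIndependent ℚ fun k : Fin n => zeta n f k := by
  have hdeg := natDegree_fpoly n hf0
  have hne : fpoly n f ≠ 0 := by
    rintro h
    rw [h, natDegree_zero] at hdeg
    omega
  refine linearIndependent_of_top_le_span_of_card_eq_finrank (span_zeta_eq_top hn hf0).ge ?_
  rw [(AdjoinRoot.powerBasis hne).finrank, AdjoinRoot.powerBasis_dim, hdeg, Fintype.card_fin]

lemma dvd_of_intCast_mul_th_mem_Rf {n : ℕ} (hn : 2 ≤ n) {f : ℕ → ℤ} (hf0 : f 0 ≠ 0) {c : ℤ}
    (h : (c : Qf n f) * th n f ∈ Rf n f) : f 0 ∣ c := by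
  obtain ⟨b, hb⟩ := (Submodule.mem_span_range_iff_exists_fun ℤ).mp h
  have hq : (f 0 : ℚ) ≠ 0 := by exact_mod_cast hf0
  have key : ∑ k : Fin n, (b k : ℚ) • zeta n f k =
      ∑ k : Fin n, (Pi.single (⟨1, hn⟩ : Fin n) ((c : ℚ) * (f 0 : ℚ)⁻¹) : Fin n → ℚ) k •
        zeta n f k := by
    symm
    rw [Fintype.sum_eq_single (⟨1, hn⟩ : Fin n)
      (fun k hk => by rw [Pi.single_eq_of_ne hk, zero_smul]), Pi.single_eq_same, mul_smul,
      ← th_eq_smul_zeta_one n hf0, Int.cast_smul_eq_zsmul, zsmul_eq_mul, ← hb]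
    simp only [Int.cast_smul_eq_zsmul]
  have h1 := Fintype.linearIndependent_iffₛ.mp (linearIndependent_zeta hn hf0) _ _ key ⟨1, hn⟩
  rw [Pi.single_eq_same, eq_mul_inv_iff_mul_eq₀ hq] at h1
  exact ⟨b ⟨1, hn⟩, by rw [mul_comm]; exact_mod_cast h1.symm⟩

lemma zetaSum_add_mem_Ish {n : ℕ} (f : ℕ → ℤ) {k : ℕ} (hk : k < n) :
    zetaSum n f k + f k ∈ Ish n f :=
  Submodule.subset_span ⟨⟨k, hk⟩, sum_range_succ_eq_zetaSum_add n f k⟩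

lemma Ish_le {n : ℕ} {f : ℕ → ℤ} {M : Submodule ℤ (Qf n f)}
    (h : ∀ k < n, zetaSum n f k + f k ∈ M) : Ish n f ≤ M := by
  rw [Ish, Submodule.span_le]
  rintro _ ⟨k, rfl⟩
  change ∑ i ∈ Finset.range ((k : ℕ) + 1), _ ∈ M
  rw [sum_range_succ_eq_zetaSum_add]
  exact h k k.2

lemma Ish_le_Rf {n : ℕ} (hn : 0 < n) (f : ℕ → ℤ) : Ish n f ≤ Rf n f :=
  Ish_le fun _ hk => add_mem (zetaSum_mem_Rf hn f hk.le) (intCast_mem_Rf hn f _)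

lemma th_mul_mem_Rf_of_mem_Ish {n : ℕ} (hn : 0 < n) {f : ℕ → ℤ} {x : Qf n f}
    (hx : x ∈ Ish n f) : th n f * x ∈ Rf n f := by
  have h : Ish n f ≤ (Rf n f).comap (LinearMap.mulLeft ℤ (th n f)) := Ish_le fun k hk => by
    rw [Submodule.mem_comap, LinearMap.mulLeft_apply, ← zetaSum_succ]
    exact zetaSum_mem_Rf hn f hk
  exact h hx

/-- Every element of `R_f` is congruent to an integer modulo `I_f^#`. -/
lemma exists_intCast_sub_mem_Ish {n : ℕ} {f : ℕ → ℤ} {x : Qf n f} (hx : x ∈ Rf n f) :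
    ∃ c : ℤ, x - c ∈ Ish n f := by
  induction hx using Submodule.span_induction with
  | zero => exact ⟨0, by simp⟩
  | add x y _ _ hx hy =>
    obtain ⟨c, hc⟩ := hx
    obtain ⟨d, hd⟩ := hy
    refine ⟨c + d, ?_⟩
    rw [Int.cast_add, add_sub_add_comm]
    exact add_mem hc hd
  | smul a x _ hx =>
    obtain ⟨c, hc⟩ := hx
    refine ⟨a * c, ?_⟩
    rw [zsmul_eq_mul, Int.cast_mul, ← mul_sub]
    exact intCast_mul_mem a hc
  | mem x hx =>
    obtain ⟨k, rfl⟩ := hx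
    change ∃ c : ℤ, zeta n f k - c ∈ Ish n f
    rcases eq_or_ne (k : ℕ) 0 with hk | hk
    · exact ⟨1, by simp [hk, zeta_zero]⟩
    · refine ⟨-f k, ?_⟩
      rw [zeta_of_ne_zero hk, Int.cast_neg, sub_neg_eq_add]
      exact zetaSum_add_mem_Ish f k.2

/-- `I_f^# = (R_f : I_f) = {x ∈ Q_f : x I_f ⊆ R_f}`. -/
theorem stmt7 (n : ℕ) (hn : 2 ≤ n) (f : ℕ → ℤ) (hf0 : f 0 ≠ 0) :
    ∀ x : Qf n f, x ∈ Ish n f ↔ ∀ y ∈ If n f, x * y ∈ Rf n f := by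
  have hpos : 0 < n := by omega
  intro x
  constructor
  · intro hx y hy
    suffices h : If n f ≤ (Rf n f).comap (LinearMap.mulLeft ℤ x) from h hy
    refine Submodule.mul_le.mpr fun r hr s hs => ?_
    rw [Submodule.mem_comap, LinearMap.mulLeft_apply, mul_left_comm]
    refine mul_mem_Rf hpos hr ?_
    obtain ⟨a, b, rfl⟩ := Submodule.mem_span_pair.mp hs
    rw [mul_add, mul_smul_comm, mul_smul_comm, mul_one, mul_comm x]
    exact add_mem (zsmul_mem (Ish_le_Rf hpos f hx) a)
      (zsmul_mem (th_mul_mem_Rf_of_mem_Ish hpos hx) b)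
  · intro h
    have hmem : ∀ s ∈ ({1, th n f} : Set (Qf n f)), x * s ∈ Rf n f := fun s hs =>
      h s (one_mul s ▸ Submodule.mul_mem_mul (one_mem_Rf hpos f) (Submodule.subset_span hs))
    have hx : x ∈ Rf n f := by simpa using hmem 1 (by simp)
    obtain ⟨c, hc⟩ := exists_intCast_sub_mem_Ish hx
    have hcth : (c : Qf n f) * th n f ∈ Rf n f := by
      have := sub_mem (hmem (th n f) (by simp)) (th_mul_mem_Rf_of_mem_Ish hpos hc)
      rwa [mul_comm x, mul_sub, sub_sub_cancel, mul_comm] at this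
    obtain ⟨d, rfl⟩ := dvd_of_intCast_mul_th_mem_Rf hn hf0 hcth
    have h0 : (f 0 : Qf n f) ∈ Ish n f := by
      simpa [zetaSum_zero] using zetaSum_add_mem_Ish f hpos
    rw [← sub_add_cancel x ((f 0 * d : ℤ) : Qf n f)]
    refine add_mem hc ?_
    rw [Int.cast_mul, mul_comm]
    exact intCast_mul_mem d h0

end
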